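/- Let w(n) be a stable sequence with limiting partition (S_1,…,S_r), where r ≥ 2, let 1 ≤ m < r, and let Q = S_1 ∪ … ∪ S_m. Assume that the |Q|×|Q| matrices f(λ|_Q, w(n)|_Q) converge entrywise as n → ∞. Then for every N with 1 ≤ N ≤ 2|Q|−1, the sequence f_N(λ, w(n)) converges, and lim_{n→∞} f_N(λ, w(n)) = lim_{n→∞} f_N(λ|_Q, w(n)|_Q). -/

import Mathlib

noncomputable section
open Polynomial Filter Topology ENNReal

/-- The inner product `⟨p,q⟩_v = ∑ₖ p(μₖ)q(μₖ)vₖ`. -/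
def ip {m : ℕ} (μ v : Fin m → ℝ) (p q : ℝ[X]) : ℝ :=
  ∑ k, p.eval (μ k) * q.eval (μ k) * v k

/-- Pair `(pₙ, pₙ₋₁)` of monic orthogonal polynomials (with `p₋₁ = 0`). -/
def opAux {m : ℕ} (μ v : Fin m → ℝ) : ℕ → ℝ[X] × ℝ[X]
  | 0 => (1, 0)
  | n + 1 =>
    let P := opAux μ v n
    ((X - C (ip μ v P.1 (X * P.1) / ip μ v P.1 P.1)) * P.1
        - C (ip μ v P.1 P.1 / ip μ v P.2 P.2) * P.2, P.1)

/-- The `n`-th monic orthogonal polynomial of the recursion. -/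
def op {m : ℕ} (μ v : Fin m → ℝ) (n : ℕ) : ℝ[X] := (opAux μ v n).1

/-- The entry `a_N` of the Jacobi matrix construction: for odd `N = 2n+1` the diagonal
entry `a_{2n+1} = ⟨pₙ, Xpₙ⟩/⟨pₙ,pₙ⟩`, for even `N = 2n` the off-diagonal entry
`a_{2n} = √(⟨pₙ,pₙ⟩/⟨pₙ₋₁,pₙ₋₁⟩)`. -/
def fEnt {m : ℕ} (μ v : Fin m → ℝ) (N : ℕ) : ℝ :=
  if N % 2 = 1 then
    ip μ v (op μ v (N / 2)) (X * op μ v (N / 2)) / ip μ v (op μ v (N / 2)) (op μ v (N / 2))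
  else
    Real.sqrt (ip μ v (op μ v (N / 2)) (op μ v (N / 2)) /
      ip μ v (op μ v (N / 2 - 1)) (op μ v (N / 2 - 1)))

/-- The symmetric tridiagonal matrix `f(μ, v)` with diagonal `a₁,a₃,…` and
sub/super-diagonal `a₂,a₄,…`. -/
def Jmat {m : ℕ} (μ v : Fin m → ℝ) : Matrix (Fin m) (Fin m) ℝ :=
  Matrix.of fun i j =>
    if i = j then fEnt μ v (2 * (i : ℕ) + 1)
    else if (i : ℕ) + 1 = (j : ℕ) ∨ (j : ℕ) + 1 = (i : ℕ) then fEnt μ v ((i : ℕ) + (j : ℕ) + 1)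
    else 0

/-- Restriction of `g : Fin d → ℝ` to a subset `Q`, reindexed in increasing order. -/
def restr {d : ℕ} (Q : Finset (Fin d)) (g : Fin d → ℝ) : Fin Q.card → ℝ :=
  fun k => g ((Q.orderIsoOfFin rfl) k).1

/-- Leading `i × i` principal submatrix. -/
def leadSub {d : ℕ} (J : Matrix (Fin d) (Fin d) ℝ) (i : ℕ) (h : i ≤ d) :
    Matrix (Fin i) (Fin i) ℝ :=
  Matrix.of fun a b => J ⟨a.1, lt_of_lt_of_le a.2 h⟩ ⟨b.1, lt_of_lt_of_le b.2 h⟩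

/-- A sequence of positive weight vectors is stable if all pairwise ratios converge
in `[0,∞]`. -/
def Stable {d : ℕ} (w : ℕ → Fin d → ℝ) : Prop :=
  (∀ n i, 0 < w n i) ∧
    ∀ i j : Fin d, ∃ L : ℝ≥0∞,
      Tendsto (fun n => ENNReal.ofReal (w n i / w n j)) atTop (𝓝 L)

/-- `S : Fin r → Finset (Fin d)` is an ordered partition of `{0,…,d-1}`. -/
def OrdPart {d r : ℕ} (S : Fin r → Finset (Fin d)) : Prop :=
  (∀ j, (S j).Nonempty) ∧ (∀ j k, j ≠ k → Disjoint (S j) (S k)) ∧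
    Finset.univ.biUnion S = (Finset.univ : Finset (Fin d))

/-- `S` is the limiting partition of the stable sequence `w`. -/
def LimPart {d r : ℕ} (w : ℕ → Fin d → ℝ) (S : Fin r → Finset (Fin d)) : Prop :=
  OrdPart S ∧
  (∀ i j : Fin d, (∃ a, i ∈ S a ∧ j ∈ S a) ↔
      ∃ L : ℝ, 0 < L ∧ Tendsto (fun n => w n i / w n j) atTop (𝓝 L)) ∧
  (∀ a b : Fin r, a < b → ∀ i ∈ S a, ∀ j ∈ S b,
      Tendsto (fun n => w n i / w n j) atTop atTop)

/-- The constant `C_i^T = ∏_{t ∈ T} (λ_t − λ_i)²`. -/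
def Cc {d : ℕ} (lam : Fin d → ℝ) (i : Fin d) (T : Finset (Fin d)) : ℝ :=
  ∏ t ∈ T, (lam t - lam i) ^ 2

/-- Offset `∑_{k<j} |S_k|` of the `j`-th block. -/
def offS {d r : ℕ} (S : Fin r → Finset (Fin d)) (j : Fin r) : ℕ :=
  ∑ k ∈ Finset.univ.filter (· < j), (S k).card

/-- The block-diagonal matrix whose `j`-th block (in rows/columns
`offS S j, …, offS S j + |S_j| - 1`) is `Jmat (restr (S j) lam) (restr (S j) (v j))`. -/
def blockDiag {d r : ℕ} (lam : Fin d → ℝ) (S : Fin r → Finset (Fin d))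
    (v : Fin r → Fin d → ℝ) : Matrix (Fin d) (Fin d) ℝ :=
  Matrix.of fun p q =>
    ∑ j : Fin r,
      if h : offS S j ≤ (p : ℕ) ∧ (p : ℕ) < offS S j + (S j).card ∧
          offS S j ≤ (q : ℕ) ∧ (q : ℕ) < offS S j + (S j).card then
        Jmat (restr (S j) lam) (restr (S j) (v j))
          ⟨(p : ℕ) - offS S j, by omega⟩ ⟨(q : ℕ) - offS S j, by omega⟩
      else 0

/-- Nonempty subsets of `Fin d`. -/
abbrev NES (d : ℕ) := {S : Finset (Fin d) // S.Nonempty}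

/-- The ambient Euclidean space of families `(w^S)` indexed by nonempty subsets. -/
abbrev Ew (d : ℕ) := NES d → Fin d → ℝ

/-- The blow-up `B` (normalized representatives): support, nonnegativity,
normalization, and the quadratic equations. -/
def Bset {d : ℕ} (lam : Fin d → ℝ) : Set (Ew d) :=
  {w | (∀ S : NES d, ∀ n, n ∉ S.1 → w S n = 0) ∧
    (∀ S n, 0 ≤ w S n) ∧
    (∀ S : NES d, ∑ n ∈ S.1, w S n = 1) ∧
    ∀ R S : NES d, R.1 ⊆ S.1 → ∀ i ∈ R.1, ∀ j ∈ R.1,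
      Cc lam i (S.1 \ R.1) * w R j * w S i = Cc lam j (S.1 \ R.1) * w R i * w S j}

/-- `𝒥̄^Λ`: symmetric tridiagonal matrices with nonnegative off-diagonal entries and
characteristic polynomial `∏ (X − λ_k)`. -/
def Jset {d : ℕ} (lam : Fin d → ℝ) : Set (Matrix (Fin d) (Fin d) ℝ) :=
  {J | (∀ i j, J i j = J j i) ∧
    (∀ i j : Fin d, (i : ℕ) + 2 ≤ (j : ℕ) ∨ (j : ℕ) + 2 ≤ (i : ℕ) → J i j = 0) ∧
    (∀ i j : Fin d, (i : ℕ) + 1 = (j : ℕ) → 0 ≤ J i j) ∧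
    J.charpoly = ∏ k, (X - C (lam k))}

/-- `K_j = S_j ∪ S_{j+1} ∪ … ∪ S_r`. -/
def Kof {d r : ℕ} (S : Fin r → Finset (Fin d)) (j : Fin r) : Finset (Fin d) :=
  (Finset.univ.filter (j ≤ ·)).biUnion S

/-- The piece `Z(P)` of `B` corresponding to the ordered partition `P = (S_1,…,S_r)`:
for every nonempty `T`, the support of `w^T` is `T ∩ S_{i(T,P)}`. -/
def Zset {d : ℕ} (lam : Fin d → ℝ) {r : ℕ} (S : Fin r → Finset (Fin d)) : Set (Ew d) :=
  {w | w ∈ Bset lam ∧ ∀ T : NES d, ∃ j : Fin r, T.1 ⊆ Kof S j ∧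
    (∀ k, T.1 ⊆ Kof S k → k ≤ j) ∧ ∀ n : Fin d, w T n ≠ 0 ↔ n ∈ T.1 ∧ n ∈ S j}

/-- `R ⪯ S`: the ordered partition `R` refines `S`, i.e. `R` is the concatenation of
ordered partitions of `S_1`, then `S_2`, etc. -/
def Refines {d q r : ℕ} (R : Fin q → Finset (Fin d)) (S : Fin r → Finset (Fin d)) : Prop :=
  ∃ b : Fin (r + 1) → ℕ, b 0 = 0 ∧ b (Fin.last r) = q ∧
    (∀ i j : Fin (r + 1), i ≤ j → b i ≤ b j) ∧
    ∀ i : Fin r, S i = (Finset.univ.filter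
      (fun k : Fin q => b i.castSucc ≤ (k : ℕ) ∧ (k : ℕ) < b i.succ)).biUnion R

/-- The `j`-th consecutive interval `I_j(T)` of lengths `|T_1|,…,|T_r|`. -/
def Iint {d r : ℕ} (T : Fin r → Finset (Fin d)) (j : Fin r) : Finset (Fin d) :=
  Finset.univ.filter (fun m : Fin d => offS T j ≤ (m : ℕ) ∧ (m : ℕ) < offS T j + (T j).card)

/-- `H(T) = {σ : σ(T_j) = I_j(T) for all j}`. -/
def Hset {d r : ℕ} (T : Fin r → Finset (Fin d)) : Set (Equiv.Perm (Fin d)) :=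
  {σ | ∀ j, (T j).image σ = Iint T j}

/-- Interval Young subgroups: setwise stabilizers of a division of `{0,…,d-1}` into
consecutive intervals. -/
def IsIntervalYoung {d : ℕ} (G : Set (Equiv.Perm (Fin d))) : Prop :=
  ∃ (q : ℕ) (c : Fin q → Finset (Fin d)), OrdPart c ∧ (∀ j : Fin q, c j = Iint c j) ∧
    G = {τ : Equiv.Perm (Fin d) | ∀ j, (c j).image ⇑τ = c j}

/-- Number of surjections from an `a`-element set onto a `b`-element set. -/
def Surj (a b : ℕ) : ℕ := Fintype.card {f : Fin a → Fin b // Function.Surjective f}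

/-- The Euler characteristic `χ_d = ∑_{q=1}^d (−2)^{d−q}·Surj(d,q)`. -/
def chi (a : ℕ) : ℝ := ∑ q ∈ Finset.Icc 1 a, (-2 : ℝ) ^ (a - q) * (Surj a q : ℝ)
/-! ### The form `ip` and its orthogonal polynomials -/

lemma ip_comm {m : ℕ} (μ v : Fin m → ℝ) (p q : ℝ[X]) : ip μ v p q = ip μ v q p :=
  Finset.sum_congr rfl fun _ _ => by ring

lemma ip_add_right {m : ℕ} (μ v : Fin m → ℝ) (p q r : ℝ[X]) :
    ip μ v p (q + r) = ip μ v p q + ip μ v p r := by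
  simp only [ip, ← Finset.sum_add_distrib, eval_add]
  exact Finset.sum_congr rfl fun _ _ => by ring

lemma ip_sub_left {m : ℕ} (μ v : Fin m → ℝ) (p q r : ℝ[X]) :
    ip μ v (p - q) r = ip μ v p r - ip μ v q r := by
  simp only [ip, ← Finset.sum_sub_distrib, eval_sub]
  exact Finset.sum_congr rfl fun _ _ => by ring

lemma ip_C_mul_left {m : ℕ} (μ v : Fin m → ℝ) (c : ℝ) (p q : ℝ[X]) :
    ip μ v (C c * p) q = c * ip μ v p q := by
  simp only [ip, Finset.mul_sum, eval_mul, eval_C]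
  exact Finset.sum_congr rfl fun _ _ => by ring

lemma ip_C_mul_right {m : ℕ} (μ v : Fin m → ℝ) (c : ℝ) (p q : ℝ[X]) :
    ip μ v p (C c * q) = c * ip μ v p q := by
  rw [ip_comm, ip_C_mul_left, ip_comm]

lemma ip_X_mul {m : ℕ} (μ v : Fin m → ℝ) (p q : ℝ[X]) :
    ip μ v (X * p) q = ip μ v p (X * q) := by
  simp only [ip, eval_mul, eval_X]
  exact Finset.sum_congr rfl fun _ _ => by ring

lemma ip_self_nonneg {m : ℕ} (μ v : Fin m → ℝ) (hv : ∀ k, 0 ≤ v k) (p : ℝ[X]) :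
    0 ≤ ip μ v p p :=
  Finset.sum_nonneg fun k _ => mul_nonneg (mul_self_nonneg _) (hv k)

lemma ip_self_pos {m : ℕ} {μ v : Fin m → ℝ} (hμ : Function.Injective μ) (hv : ∀ k, 0 < v k)
    {p : ℝ[X]} (hp : p ≠ 0) (hdeg : p.degree < m) : 0 < ip μ v p p := by
  refine lt_of_le_of_ne (ip_self_nonneg μ v (fun k => (hv k).le) p) fun h => hp ?_
  have h0 := (Finset.sum_eq_zero_iff_of_nonneg
    fun k _ => mul_nonneg (mul_self_nonneg (p.eval (μ k))) (hv k).le).1 h.symm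
  refine Polynomial.eq_zero_of_degree_lt_of_eval_index_eq_zero Finset.univ
    hμ.injOn (by simpa using hdeg) fun k hk => ?_
  simpa [(hv k).ne'] using h0 k hk

lemma op_one {m : ℕ} (μ v : Fin m → ℝ) :
    op μ v 1 = X - C (ip μ v (op μ v 0) (X * op μ v 0) / ip μ v (op μ v 0) (op μ v 0)) := by
  simp [op, opAux]

lemma op_add_two {m : ℕ} (μ v : Fin m → ℝ) (k : ℕ) :
    op μ v (k + 2) = (X - C (ip μ v (op μ v (k + 1)) (X * op μ v (k + 1)) /
        ip μ v (op μ v (k + 1)) (op μ v (k + 1)))) * op μ v (k + 1)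
      - C (ip μ v (op μ v (k + 1)) (op μ v (k + 1)) / ip μ v (op μ v k) (op μ v k)) *
        op μ v k := rfl

lemma degree_C_mul_lt {p : ℝ[X]} {n : ℕ} (c : ℝ) (hp : p.degree < (n : WithBot ℕ)) :
    (C c * p).degree < (n : WithBot ℕ) := by
  rw [degree_lt_iff_coeff_zero] at hp ⊢
  intro j hj
  rw [coeff_C_mul, hp j hj, mul_zero]

lemma op_monic_degree {m : ℕ} (μ v : Fin m → ℝ) (k : ℕ) :
    (op μ v k).Monic ∧ (op μ v k).degree = k := by
  induction k using Nat.strong_induction_on with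
  | _ k ih =>
    match k with
    | 0 => exact ⟨monic_one, degree_one⟩
    | 1 => rw [op_one]; exact ⟨monic_X_sub_C _, degree_X_sub_C _⟩
    | k + 2 =>
      obtain ⟨h1, d1⟩ := ih (k + 1) (by omega)
      obtain ⟨-, d0⟩ := ih k (by omega)
      rw [op_add_two]
      have hM := (monic_X_sub_C (ip μ v (op μ v (k + 1)) (X * op μ v (k + 1)) /
        ip μ v (op μ v (k + 1)) (op μ v (k + 1)))).mul h1
      have hd : ((X - C (ip μ v (op μ v (k + 1)) (X * op μ v (k + 1)) /
          ip μ v (op μ v (k + 1)) (op μ v (k + 1)))) * op μ v (k + 1)).degree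
          = ((k + 2 : ℕ) : WithBot ℕ) := by
        rw [degree_mul, degree_X_sub_C, d1]; norm_cast; omega
      have hlt : (C (ip μ v (op μ v (k + 1)) (op μ v (k + 1)) / ip μ v (op μ v k) (op μ v k)) *
          op μ v k).degree < ((k + 2 : ℕ) : WithBot ℕ) := by
        refine degree_C_mul_lt _ ?_
        rw [d0]; norm_cast; omega
      rw [← hd] at hlt
      exact ⟨hM.sub_of_left hlt, by rw [degree_sub_eq_left_of_degree_lt hlt, hd]⟩

lemma op_self_pos {m : ℕ} {μ v : Fin m → ℝ} (hμ : Function.Injective μ) (hv : ∀ k, 0 < v k)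
    {k : ℕ} (hk : k < m) : 0 < ip μ v (op μ v k) (op μ v k) :=
  ip_self_pos hμ hv (op_monic_degree μ v k).1.ne_zero
    (by rw [(op_monic_degree μ v k).2]; exact_mod_cast hk)

/-- A polynomial of degree at most `k` is a multiple of a monic polynomial of degree `k` plus a
polynomial of smaller degree. -/
lemma exists_eq_C_mul_add {p q : ℝ[X]} {k : ℕ} (hp : p.Monic) (hd : p.degree = k)
    (hq : q.degree < ((k + 1 : ℕ) : WithBot ℕ)) :
    ∃ (c : ℝ) (r : ℝ[X]), q = C c * p + r ∧ r.degree < (k : WithBot ℕ) := by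
  refine ⟨q.coeff k, q - C (q.coeff k) * p, by ring, ?_⟩
  have hn : p.natDegree = k := natDegree_eq_of_degree_eq_some hd
  rw [degree_lt_iff_coeff_zero] at hq ⊢
  intro j hj
  rcases hj.eq_or_lt with rfl | hj
  · have : p.coeff k = 1 := by rw [← hn]; exact hp.coeff_natDegree
    simp [this]
  · have : p.coeff j = 0 := coeff_eq_zero_of_natDegree_lt (by omega)
    simp [this, hq j (by omega)]

lemma ip_op_eq_zero {m : ℕ} {μ v : Fin m → ℝ} (hμ : Function.Injective μ) (hv : ∀ k, 0 < v k)
    {k : ℕ} (hk : k ≤ m) {q : ℝ[X]} (hq : q.degree < (k : WithBot ℕ)) :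
    ip μ v (op μ v k) q = 0 := by
  induction k using Nat.strong_induction_on generalizing q with
  | _ k ih =>
    match k with
    | 0 =>
      have : q = 0 := by simpa [Nat.WithBot.lt_zero_iff] using hq
      simp [this, ip]
    | 1 =>
      have hpos := op_self_pos hμ hv (show 0 < m by omega)
      have hq0 : q = C (q.coeff 0) * op μ v 0 := by
        rw [show op μ v 0 = 1 from rfl, mul_one]
        refine eq_C_of_natDegree_eq_zero ?_
        by_cases h : q = 0
        · simp [h]
        · exact Nat.lt_one_iff.1 ((natDegree_lt_iff_degree_lt h).2 hq)
      have hX : op μ v 1 = X * op μ v 0 -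
          C (ip μ v (op μ v 0) (X * op μ v 0) / ip μ v (op μ v 0) (op μ v 0)) * op μ v 0 := by
        rw [op_one, show op μ v 0 = 1 from rfl, mul_one, mul_one]
      rw [hq0, hX, ip_C_mul_right, ip_sub_left, ip_C_mul_left, ip_X_mul]
      field_simp
      ring
    | k + 2 =>
      have pos1 := op_self_pos hμ hv (show k + 1 < m by omega)
      have pos0 := op_self_pos hμ hv (show k < m by omega)
      obtain ⟨m1, d1⟩ := op_monic_degree μ v (k + 1)
      obtain ⟨m0, d0⟩ := op_monic_degree μ v k
      obtain ⟨c, r, rfl, hr⟩ := exists_eq_C_mul_add m1 d1 hq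
      obtain ⟨c', s, rfl, hs⟩ := exists_eq_C_mul_add m0 d0 hr
      have expand : ∀ u, ip μ v (op μ v (k + 2)) u = ip μ v (op μ v (k + 1)) (X * u)
          - ip μ v (op μ v (k + 1)) (X * op μ v (k + 1)) /
            ip μ v (op μ v (k + 1)) (op μ v (k + 1)) * ip μ v (op μ v (k + 1)) u
          - ip μ v (op μ v (k + 1)) (op μ v (k + 1)) / ip μ v (op μ v k) (op μ v k) *
            ip μ v (op μ v k) u := by
        intro u
        rw [op_add_two, ip_sub_left, sub_mul, ip_sub_left, ip_C_mul_left, ip_C_mul_left,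
          ip_X_mul]
      have horth : ∀ u : ℝ[X], u.degree < ((k + 1 : ℕ) : WithBot ℕ) →
          ip μ v (op μ v (k + 1)) u = 0 := fun u hu => ih (k + 1) (by omega) (by omega) hu
      have hXlt : ∀ {u : ℝ[X]} {j : ℕ}, u.degree < (j : WithBot ℕ) →
          (X * u).degree < ((j + 1 : ℕ) : WithBot ℕ) := by
        intro u j hu
        rw [degree_lt_iff_coeff_zero] at hu ⊢
        intro i hi
        obtain ⟨i, rfl⟩ : ∃ i', i = i' + 1 := ⟨i - 1, by omega⟩
        rw [coeff_X_mul]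
        exact hu i (by omega)
      have e1 : ip μ v (op μ v (k + 2)) (op μ v (k + 1)) = 0 := by
        rw [expand, ip_comm μ v (op μ v k) (op μ v (k + 1)), horth (op μ v k) (by rw [d0]; norm_cast; omega)]
        field_simp
        ring
      have e2 : ip μ v (op μ v (k + 2)) (op μ v k) = 0 := by
        obtain ⟨c, t, ht, htd⟩ := exists_eq_C_mul_add (q := X * op μ v k - op μ v (k + 1))
          m0 d0 (by
            have hX : (X * op μ v k).degree = (op μ v (k + 1)).degree := by
              rw [degree_mul, degree_X, d0, d1]; norm_cast; omega
            rw [← d1, ← hX]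
            refine degree_sub_lt_left hX (by simp [m0.ne_zero]) ?_
            rw [m1.leadingCoeff, (monic_X.mul m0).leadingCoeff])
        have hX : X * op μ v k = op μ v (k + 1) + (C c * op μ v k + t) := by rw [← ht]; ring
        have hlow : (C c * op μ v k + t).degree < ((k + 1 : ℕ) : WithBot ℕ) := by
          refine (degree_add_le _ _).trans_lt (max_lt (degree_C_mul_lt _ ?_) ?_)
          · rw [d0]; norm_cast; omega
          · exact htd.trans (by norm_cast; omega)
        rw [expand, horth (op μ v k) (by rw [d0]; norm_cast; omega), hX, ip_add_right,
          horth _ hlow]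
        field_simp
        ring
      have e3 : ip μ v (op μ v (k + 2)) s = 0 := by
        rw [expand, horth _ (hXlt hs), horth s (hs.trans (by norm_cast; omega)),
          ih k (by omega) (by omega) hs]
        ring
      rw [ip_add_right, ip_add_right, ip_C_mul_right, ip_C_mul_right, e1, e2, e3]
      ring

/-- Pythagoras: the orthogonal polynomial has minimal norm among monic polynomials of its
degree. -/
lemma ip_self_eq_op_add {m : ℕ} {μ v : Fin m → ℝ} (hμ : Function.Injective μ)
    (hv : ∀ k, 0 < v k) {k : ℕ} (hk : k ≤ m) {p : ℝ[X]} (hp : p.Monic) (hd : p.degree = k) :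
    ip μ v p p = ip μ v (op μ v k) (op μ v k) + ip μ v (p - op μ v k) (p - op μ v k) := by
  obtain ⟨m0, d0⟩ := op_monic_degree μ v k
  have h0 : ip μ v (op μ v k) (p - op μ v k) = 0 := by
    refine ip_op_eq_zero hμ hv hk ?_
    rw [← hd]
    exact degree_sub_lt_left (by rw [hd, d0]) hp.ne_zero (by rw [hp.leadingCoeff, m0.leadingCoeff])
  have key : ip μ v p p = ip μ v (op μ v k) (op μ v k) + ip μ v (p - op μ v k) (p - op μ v k) +
      2 * ip μ v (op μ v k) (p - op μ v k) := by
    simp only [ip, Finset.mul_sum, ← Finset.sum_add_distrib, eval_sub]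
    exact Finset.sum_congr rfl fun _ _ => by ring
  rw [key, h0, mul_zero, add_zero]

lemma abs_sum_mul_le {ι : Type*} (s : Finset ι) (f g x v : ι → ℝ) {M : ℝ}
    (hx : ∀ k, |x k| ≤ M) (hv : ∀ k, 0 ≤ v k) (hM : 0 ≤ M) :
    |∑ k ∈ s, f k * (x k * g k) * v k| ≤
      M * (√(∑ k ∈ s, f k * f k * v k) * √(∑ k ∈ s, g k * g k * v k)) := by
  have hCS := Real.sum_mul_le_sqrt_mul_sqrt s (fun k => |f k| * √(v k)) fun k => |g k| * √(v k)
  have hsq : ∀ h : ι → ℝ, ∑ k ∈ s, (|h k| * √(v k)) ^ 2 = ∑ k ∈ s, h k * h k * v k := fun h =>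
    Finset.sum_congr rfl fun k _ => by rw [mul_pow, Real.sq_sqrt (hv k), sq_abs]; ring
  rw [hsq, hsq] at hCS
  refine (Finset.abs_sum_le_sum_abs _ _).trans ?_
  refine le_trans ?_ (mul_le_mul_of_nonneg_left hCS hM)
  rw [Finset.mul_sum]
  refine Finset.sum_le_sum fun k _ => ?_
  have : |f k| * √(v k) * (|g k| * √(v k)) = |f k| * |g k| * v k := by
    rw [mul_mul_mul_comm, Real.mul_self_sqrt (hv k)]
  rw [this, abs_mul, abs_mul, abs_mul, abs_of_nonneg (hv k)]
  have := mul_le_mul_of_nonneg_right (hx k)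
    (mul_nonneg (mul_nonneg (abs_nonneg (f k)) (abs_nonneg (g k))) (hv k))
  nlinarith

lemma abs_ip_X_mul_le {m : ℕ} (μ v : Fin m → ℝ) {M : ℝ} (hμ : ∀ k, |μ k| ≤ M)
    (hv : ∀ k, 0 ≤ v k) (hM : 0 ≤ M) (p q : ℝ[X]) :
    |ip μ v p (X * q)| ≤ M * (√(ip μ v p p) * √(ip μ v q q)) := by
  simpa only [ip, eval_mul, eval_X] using
    abs_sum_mul_le Finset.univ (fun k => p.eval (μ k)) (fun k => q.eval (μ k)) μ v hμ hv hM

/-! ### Comparison of the full form with its restriction -/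

lemma ip_restr {d : ℕ} (Q : Finset (Fin d)) (lam v : Fin d → ℝ) (p q : ℝ[X]) :
    ip (restr Q lam) (restr Q v) p q = ∑ k ∈ Q, p.eval (lam k) * q.eval (lam k) * v k := by
  rw [← Finset.sum_coe_sort Q]
  exact (Q.orderIsoOfFin rfl).toEquiv.sum_comp
    fun k : Q => p.eval (lam k) * q.eval (lam k) * v k

lemma ip_eq_ip_restr_add {d : ℕ} (Q : Finset (Fin d)) (lam v : Fin d → ℝ) (p q : ℝ[X]) :
    ip lam v p q = ip (restr Q lam) (restr Q v) p q +
      ∑ k ∈ Qᶜ, p.eval (lam k) * q.eval (lam k) * v k := by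
  rw [ip_restr, Finset.sum_add_sum_compl]; rfl

lemma restr_injective {d : ℕ} (Q : Finset (Fin d)) {g : Fin d → ℝ} (hg : Function.Injective g) :
    Function.Injective (restr Q g) := fun _ _ h =>
  (Q.orderIsoOfFin rfl).injective (Subtype.ext (hg h))

/-- On polynomials of degree less than `|Q|`, the points outside `Q` contribute at most a
multiple of the form restricted to `Q`. -/
lemma exists_sum_compl_le {d : ℕ} (Q : Finset (Fin d)) {lam : Fin d → ℝ}
    (hlam : Function.Injective lam) :
    ∃ K : ℝ, ∀ v : Fin d → ℝ, (∀ k, 0 < v k) → ∀ p : ℝ[X],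
      p.degree < (Q.card : WithBot ℕ) →
      ∑ k ∈ Qᶜ, p.eval (lam k) * p.eval (lam k) * v k ≤
        (K * ∑ j ∈ Qᶜ, ∑ i ∈ Q, v j / v i) * ip (restr Q lam) (restr Q v) p p := by
  set K : ℝ := ∑ j, ∑ i ∈ Q, (Lagrange.basis Q lam i).eval (lam j) ^ 2
  have hK0 : 0 ≤ K := Finset.sum_nonneg fun _ _ => Finset.sum_nonneg fun _ _ => sq_nonneg _
  refine ⟨K, fun v hv p hp => ?_⟩
  rw [mul_assoc, Finset.sum_mul (s := Qᶜ), Finset.mul_sum (s := Qᶜ)]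
  refine Finset.sum_le_sum fun j _ => ?_
  have hev : p.eval (lam j) =
      ∑ i ∈ Q, p.eval (lam i) * (Lagrange.basis Q lam i).eval (lam j) := by
    conv_lhs => rw [Lagrange.eq_interpolate hlam.injOn hp, Lagrange.interpolate_apply]
    simp [eval_finsetSum]
  have hCS : p.eval (lam j) * p.eval (lam j) ≤ (∑ i ∈ Q, p.eval (lam i) ^ 2) * K := by
    rw [← sq, hev]
    refine (Finset.sum_mul_sq_le_sq_mul_sq _ _ _).trans
      (mul_le_mul_of_nonneg_left ?_ (Finset.sum_nonneg fun _ _ => sq_nonneg _))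
    exact Finset.single_le_sum
      (f := fun j => ∑ i ∈ Q, (Lagrange.basis Q lam i).eval (lam j) ^ 2)
      (fun _ _ => Finset.sum_nonneg fun _ _ => sq_nonneg _) (Finset.mem_univ j)
  refine (mul_le_mul_of_nonneg_right hCS (hv j).le).trans ?_
  rw [mul_comm _ K, mul_assoc, Finset.sum_mul (s := Q), Finset.sum_mul (s := Q)]
  refine mul_le_mul_of_nonneg_left (Finset.sum_le_sum fun i hi => ?_) hK0
  have hle : p.eval (lam i) * p.eval (lam i) * v i ≤ ip (restr Q lam) (restr Q v) p p := by
    rw [ip_restr]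
    exact Finset.single_le_sum (f := fun i => p.eval (lam i) * p.eval (lam i) * v i)
      (fun i _ => mul_nonneg (mul_self_nonneg _) (hv i).le) hi
  calc p.eval (lam i) ^ 2 * v j = v j / v i * (p.eval (lam i) * p.eval (lam i) * v i) := by
        have := (hv i).ne'
        field_simp
    _ ≤ _ := mul_le_mul_of_nonneg_left hle (div_nonneg (hv j).le (hv i).le)

/-- Comparison of the norms and of the diagonal numerators of the orthogonal polynomials for the
full and the restricted form. -/
lemma op_restr_bounds {d : ℕ} (Q : Finset (Fin d)) {lam v : Fin d → ℝ}
    (hlam : Function.Injective lam) (hv : ∀ k, 0 < v k) {M δ : ℝ} (hM0 : 0 ≤ M)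
    (hM : ∀ k, |lam k| ≤ M)
    (hδ : ∀ p : ℝ[X], p.degree < (Q.card : WithBot ℕ) →
      ∑ k ∈ Qᶜ, p.eval (lam k) * p.eval (lam k) * v k ≤
        δ * ip (restr Q lam) (restr Q v) p p)
    {k : ℕ} (hk : k < Q.card) {a b x y : ℝ}
    (ha : a = ip (restr Q lam) (restr Q v) (op (restr Q lam) (restr Q v) k)
      (op (restr Q lam) (restr Q v) k))
    (hb : b = ip lam v (op lam v k) (op lam v k))
    (hx : x = ip (restr Q lam) (restr Q v) (op (restr Q lam) (restr Q v) k)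
      (X * op (restr Q lam) (restr Q v) k))
    (hy : y = ip lam v (op lam v k) (X * op lam v k)) :
    0 < a ∧ a ≤ b ∧ b ≤ (1 + δ) * a ∧ |y - x| ≤ M * (2 * δ + 2 * √δ) * a := by
  have hinj := restr_injective Q hlam
  have hv' : ∀ k, 0 < restr Q v k := fun k => hv _
  have hkd : k ≤ d := hk.le.trans (by simpa using Q.card_le_univ)
  obtain ⟨mP, dP⟩ := op_monic_degree (restr Q lam) (restr Q v) k
  obtain ⟨mp, dp⟩ := op_monic_degree lam v k
  have hpy1 := ip_self_eq_op_add hinj hv' hk.le mp dp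
  have hpy2 := ip_self_eq_op_add hlam hv hkd mP dP
  have hapos := op_self_pos hinj hv' hk
  have hδP := hδ _ (by rw [dP]; exact_mod_cast hk)
  rw [← ha] at hpy1 hδP hapos
  rw [← hb] at hpy2
  set P := op (restr Q lam) (restr Q v) k
  set p := op lam v k
  have hBP := ip_eq_ip_restr_add Q lam v P P
  have hBp := ip_eq_ip_restr_add Q lam v p p
  rw [← ha] at hBP
  rw [← hb] at hBp
  have hDp0 : 0 ≤ ∑ k ∈ Qᶜ, p.eval (lam k) * p.eval (lam k) * v k :=
    Finset.sum_nonneg fun k _ => mul_nonneg (mul_self_nonneg _) (hv k).le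
  have hr0 := ip_self_nonneg (restr Q lam) (restr Q v) (fun k => (hv' k).le) (p - P)
  have hs0 := ip_self_nonneg lam v (fun k => (hv k).le) (P - p)
  set D := ∑ k ∈ Qᶜ, p.eval (lam k) * p.eval (lam k) * v k
  have hDle : D ≤ δ * a := by linarith
  have hrle : ip (restr Q lam) (restr Q v) (p - P) (p - P) ≤ δ * a := by linarith
  have hδ0 : 0 ≤ δ := nonneg_of_mul_nonneg_left (hr0.trans hrle) hapos
  refine ⟨hapos, by linarith, by linarith, ?_⟩
  have hM' : ∀ k, |restr Q lam k| ≤ M := fun k => hM _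
  have c1 := abs_sum_mul_le Qᶜ (fun k => p.eval (lam k)) (fun k => p.eval (lam k)) lam v hM
    (fun k => (hv k).le) hM0
  have c2 := abs_ip_X_mul_le (restr Q lam) (restr Q v) hM' (fun k => (hv' k).le) hM0 (p - P) P
  have c3 := abs_ip_X_mul_le (restr Q lam) (restr Q v) hM' (fun k => (hv' k).le) hM0
    (p - P) (p - P)
  rw [Real.mul_self_sqrt hDp0] at c1
  rw [Real.mul_self_sqrt hr0] at c3
  have hsq : √(ip (restr Q lam) (restr Q v) (p - P) (p - P)) * √a ≤ √δ * a := by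
    calc _ ≤ √(δ * a) * √a := mul_le_mul_of_nonneg_right (Real.sqrt_le_sqrt hrle)
          (Real.sqrt_nonneg a)
      _ = √δ * a := by rw [Real.sqrt_mul hδ0, mul_assoc, Real.mul_self_sqrt hapos.le]
  rw [← ha] at c2
  have hBX := ip_eq_ip_restr_add Q lam v p (X * p)
  have hp : p = P + (p - P) := by ring
  have hAX : ip (restr Q lam) (restr Q v) p (X * p) = x +
      2 * ip (restr Q lam) (restr Q v) (p - P) (X * P) +
      ip (restr Q lam) (restr Q v) (p - P) (X * (p - P)) := by
    rw [hx]
    simp only [ip, Finset.mul_sum, ← Finset.sum_add_distrib, eval_mul, eval_X, eval_sub]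
    exact Finset.sum_congr rfl fun _ _ => by ring
  rw [← hy, hAX] at hBX
  simp only [eval_mul, eval_X] at hBX
  have t1 := c1.trans (mul_le_mul_of_nonneg_left hDle hM0)
  have t2 := c2.trans (mul_le_mul_of_nonneg_left hsq hM0)
  have t3 := c3.trans (mul_le_mul_of_nonneg_left hrle hM0)
  rw [abs_le] at t1 t2 t3 ⊢
  constructor <;> nlinarith

/-! ### Limits -/

lemma tendsto_ratio_of_bounds {a b δ : ℕ → ℝ} (ha : ∀ n, 0 < a n) (hab : ∀ n, a n ≤ b n)
    (hb : ∀ n, b n ≤ (1 + δ n) * a n) (hδ : Tendsto δ atTop (𝓝 0)) :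
    Tendsto (fun n => b n / a n) atTop (𝓝 1) := by
  refine tendsto_of_tendsto_of_tendsto_of_le_of_le tendsto_const_nhds
    (by simpa using hδ.const_add 1) (fun n => (one_le_div (ha n)).2 (hab n))
    fun n => (div_le_iff₀ (ha n)).2 (hb n)

lemma tendsto_quotient_of_bounds {a b x y δ : ℕ → ℝ} {M L : ℝ} (ha : ∀ n, 0 < a n)
    (hab : ∀ n, a n ≤ b n) (hb : ∀ n, b n ≤ (1 + δ n) * a n)
    (hxy : ∀ n, |y n - x n| ≤ M * (2 * δ n + 2 * √(δ n)) * a n)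
    (hδ : Tendsto δ atTop (𝓝 0)) (hx : Tendsto (fun n => x n / a n) atTop (𝓝 L)) :
    Tendsto (fun n => y n / b n) atTop (𝓝 L) := by
  have h1 := tendsto_ratio_of_bounds ha hab hb hδ
  have hbound : Tendsto (fun n => M * (2 * δ n + 2 * √(δ n))) atTop (𝓝 0) := by
    simpa using ((hδ.const_mul 2).add (hδ.sqrt.const_mul 2)).const_mul M
  have h2 : Tendsto (fun n => (y n - x n) / a n) atTop (𝓝 0) := by
    refine squeeze_zero_norm (fun n => ?_) hbound
    rw [Real.norm_eq_abs, abs_div, abs_of_pos (ha n)]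
    exact (div_le_iff₀ (ha n)).2 (hxy n)
  have h3 := (h2.add hx).div h1 one_ne_zero
  simp only [zero_add, div_one] at h3
  refine h3.congr fun n => ?_
  have := (ha n).ne'
  have := ((ha n).trans_le (hab n)).ne'
  simp only [Pi.div_apply]
  field_simp
  ring

lemma Jmat_diag {m : ℕ} (μ v : Fin m → ℝ) (i : Fin m) :
    Jmat μ v i i = fEnt μ v (2 * (i : ℕ) + 1) := by
  simp [Jmat]

lemma Jmat_succ {m : ℕ} (μ v : Fin m → ℝ) {k : ℕ} (hk : k + 1 < m) :
    Jmat μ v ⟨k, by omega⟩ ⟨k + 1, hk⟩ = fEnt μ v (2 * (k + 1)) := by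
  simp [Jmat]
  congr 1
  ring

lemma fEnt_odd {m : ℕ} (μ v : Fin m → ℝ) (k : ℕ) :
    fEnt μ v (2 * k + 1) =
      ip μ v (op μ v k) (X * op μ v k) / ip μ v (op μ v k) (op μ v k) := by
  have h1 : (2 * k + 1) % 2 = 1 := by omega
  have h2 : (2 * k + 1) / 2 = k := by omega
  simp only [fEnt, h1, h2, if_true]

lemma fEnt_even {m : ℕ} (μ v : Fin m → ℝ) (k : ℕ) :
    fEnt μ v (2 * (k + 1)) =
      √(ip μ v (op μ v (k + 1)) (op μ v (k + 1)) / ip μ v (op μ v k) (op μ v k)) := by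
  have h1 : ¬ (2 * (k + 1)) % 2 = 1 := by omega
  have h2 : (2 * (k + 1)) / 2 = k + 1 := by omega
  simp only [fEnt, h1, h2, if_false, Nat.add_sub_cancel]

/-- Lemma 12: convergence of the first `2|Q|−1` entries. -/
theorem stmt2 {d r : ℕ} (hd : 1 ≤ d) (lam : Fin d → ℝ) (hlam : Function.Injective lam)
    (w : ℕ → Fin d → ℝ) (hstab : Stable w)
    (S : Fin r → Finset (Fin d)) (hS : LimPart w S) (hr : 2 ≤ r)
    (m : ℕ) (hm1 : 1 ≤ m) (hmr : m < r)
    (Q : Finset (Fin d))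
    (hQ : Q = (Finset.univ.filter (fun j : Fin r => (j : ℕ) < m)).biUnion S)
    (hconv : ∀ p q : Fin Q.card, ∃ L : ℝ,
      Tendsto (fun n => Jmat (restr Q lam) (restr Q (w n)) p q) atTop (𝓝 L)) :
    ∀ N : ℕ, 1 ≤ N → N ≤ 2 * Q.card - 1 →
      ∃ L : ℝ, Tendsto (fun n => fEnt lam (w n) N) atTop (𝓝 L) ∧
        Tendsto (fun n => fEnt (restr Q lam) (restr Q (w n)) N) atTop (𝓝 L) := by
  classical
  have hw := hstab.1
  obtain ⟨⟨-, -, hcover⟩, -, hsep⟩ := hS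
  have hlim : ∀ j ∈ Qᶜ, ∀ i ∈ Q, Tendsto (fun n => w n j / w n i) atTop (𝓝 0) := by
    intro j hj i hi
    rw [hQ, Finset.mem_biUnion] at hi
    obtain ⟨a, ha, hia⟩ := hi
    obtain ⟨b, -, hjb⟩ := Finset.mem_biUnion.1 (hcover.symm ▸ Finset.mem_univ j)
    have hbm : ¬ (b : ℕ) < m := fun hb => Finset.mem_compl.1 hj <| by
      rw [hQ]; exact Finset.mem_biUnion.2 ⟨b, by simpa using hb, hjb⟩
    have hab : a < b := by
      have : (a : ℕ) < m := by simpa using ha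
      exact Fin.lt_def.2 (by omega)
    exact (hsep a b hab i hia j hjb).inv_tendsto_atTop.congr fun n => inv_div _ _
  obtain ⟨K, hK⟩ := exists_sum_compl_le Q hlam
  set δ : ℕ → ℝ := fun n => K * ∑ j ∈ Qᶜ, ∑ i ∈ Q, w n j / w n i
  have hδ : Tendsto δ atTop (𝓝 0) := by
    have := (tendsto_finsetSum Qᶜ fun j hj =>
      tendsto_finsetSum Q fun i hi => hlim j hj i hi).const_mul K
    simpa using this
  set M : ℝ := ∑ k, |lam k|
  have hM0 : 0 ≤ M := Finset.sum_nonneg fun _ _ => abs_nonneg _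
  have hM : ∀ k, |lam k| ≤ M := fun k =>
    Finset.single_le_sum (f := fun k => |lam k|) (fun _ _ => abs_nonneg _) (Finset.mem_univ k)
  have hbd := fun (k : ℕ) (hk : k < Q.card) (n : ℕ) =>
    op_restr_bounds Q hlam (hw n) hM0 hM (hK (w n) (hw n)) hk rfl rfl rfl rfl
  intro N hN1 hN2
  rcases N.even_or_odd' with ⟨k, rfl | rfl⟩
  · obtain ⟨k, rfl⟩ : ∃ k', k = k' + 1 := ⟨k - 1, by omega⟩
    have hk1 : k + 1 < Q.card := by omega
    have hk0 : k < Q.card := by omega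
    obtain ⟨L, hL⟩ := hconv ⟨k, hk0⟩ ⟨k + 1, hk1⟩
    simp only [Jmat_succ] at hL
    refine ⟨L, ?_, hL⟩
    have r1 := tendsto_ratio_of_bounds (fun n => (hbd _ hk1 n).1) (fun n => (hbd _ hk1 n).2.1)
      (fun n => (hbd _ hk1 n).2.2.1) hδ
    have r0 := tendsto_ratio_of_bounds (fun n => (hbd _ hk0 n).1) (fun n => (hbd _ hk0 n).2.1)
      (fun n => (hbd _ hk0 n).2.2.1) hδ
    have h := hL.mul (r1.div r0 one_ne_zero).sqrt
    simp only [div_one, Real.sqrt_one, mul_one] at h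
    refine h.congr fun n => ?_
    have a1 := (hbd _ hk1 n).1
    have a0 := (hbd _ hk0 n).1
    have b0 := a0.trans_le (hbd _ hk0 n).2.1
    rw [fEnt_even, fEnt_even, ← Real.sqrt_mul (div_nonneg a1.le a0.le)]
    congr 1
    simp only [Pi.div_apply]
    field_simp
  · have hk : k < Q.card := by omega
    obtain ⟨L, hL⟩ := hconv ⟨k, hk⟩ ⟨k, hk⟩
    simp only [Jmat_diag] at hL
    refine ⟨L, ?_, hL⟩
    simp only [fEnt_odd] at hL ⊢
    exact tendsto_quotient_of_bounds (fun n => (hbd _ hk n).1) (fun n => (hbd _ hk n).2.1)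
      (fun n => (hbd _ hk n).2.2.1) (fun n => (hbd _ hk n).2.2.2) hδ hL
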